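/- Let x be an odd cyclic configuration such that the switch count s(F^t(x)) is constant in t (x ∈ X_s) and let b be a maximal ordered block in x. Then b does not contain the block 001100, and b does not end with 0011. -/

import Mathlib

/-- The parity (XOR of all cells) of a cyclic binary configuration. -/
def Par {n : ℕ} [NeZero n] (x : ZMod n → Bool) : ZMod 2 :=
  ∑ i : ZMod n, if x i then 1 else 0

/-- The global CA rule induced by a local rule of radius `r`
on cyclic configurations of length `n`. -/
def globalRule (r : ℕ) (f : (Fin (2*r+1) → Bool) → Bool) {n : ℕ}
    (x : ZMod n → Bool) : ZMod n → Bool :=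
  fun i => f (fun j => x (i + ((j : ℕ) : ZMod n) - (r : ZMod n)))

/-- The active (center-flipping) neighbourhoods of the corrected BFO rule
(transitions T1–T12; the center is cell 4 of 9). -/
def bfoActive (w : Fin 9 → Bool) : Bool :=
  (w 1 && w 2 && w 3 && !w 4 && !w 5) ||               -- T1
  (w 0 && w 1 && w 2 && !w 3 && !w 4) ||               -- T2
  (!w 1 && !w 2 && w 3 && !w 4 && !w 5) ||             -- T3
  (!w 0 && !w 1 && w 2 && !w 3 && !w 4) ||             -- T4
  (!w 3 && w 4 && w 5 && !w 6) ||                      -- T5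
  (!w 2 && w 3 && w 4 && !w 5) ||                      -- T6
  (!w 1 && !w 2 && w 3 && !w 4 && w 5 && !w 6) ||      -- T7
  (!w 2 && !w 3 && w 4 && !w 5 && w 6 && !w 7) ||      -- T8
  (w 3 && w 4 && w 5 && !w 6 && w 7) ||                -- T9
  (w 0 && w 1 && w 2 && !w 3 && w 4 && !w 5) ||        -- T10
  (w 0 && w 1 && w 2 && !w 3 && w 4 && w 5 && w 6) ||  -- T11
  (w 2 && w 3 && w 4 && !w 5 && w 6 && w 7 && !w 8)    -- T12

/-- The corrected BFO local rule (radius 4). -/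
def bfoLocal (w : Fin 9 → Bool) : Bool := xor (bfoActive w) (w 4)

/-- The global rule induced by the corrected BFO rule. -/
def bfoGlobal {n : ℕ} (x : ZMod n → Bool) : ZMod n → Bool :=
  globalRule 4 bfoLocal x

/-- `x i x (i+1)` is a box: the pattern 01 preceded by 1 and followed by 00. -/
def IsBox {n : ℕ} (x : ZMod n → Bool) (i : ZMod n) : Prop :=
  x (i-1) = true ∧ x i = false ∧ x (i+1) = true ∧ x (i+2) = false ∧ x (i+3) = false

/-- Cell `j` belongs to some box of `x`. -/
def InBox {n : ℕ} (x : ZMod n → Bool) (j : ZMod n) : Prop :=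
  ∃ i, IsBox x i ∧ (j = i ∨ j = i + 1)

/-- `x` has a switch at position `i`: either a b-switch (a box at `i+1`)
or an r-switch (`x i ≠ x (i+1)` with neither cell in a box). -/
def IsSwitch {n : ℕ} (x : ZMod n → Bool) (i : ZMod n) : Prop :=
  IsBox x (i+1) ∨ (x i ≠ x (i+1) ∧ ¬ InBox x i ∧ ¬ InBox x (i+1))

/-- The number of switches of the configuration `x`. -/
noncomputable def switchCount {n : ℕ} (x : ZMod n → Bool) : ℕ :=
  Nat.card {i : ZMod n // IsSwitch x i}

/-- The block of length `2k+2` starting at position `i` is an ordered block. -/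
def IsOrderedBlock {n : ℕ} (x : ZMod n → Bool) (i : ZMod n) (k : ℕ) : Prop :=
  (∀ j ≤ k, ¬ (x (i + 2*j) = true ∧ x (i + 2*j + 1) = false)) ∧
  (x i = false ∧ x (i+1) = true) ∧
  ¬ (x (i + 2*k) = false ∧ x (i + 2*k + 1) = true) ∧
  (x (i + 2*k) = true ∧ x (i + 2*k + 1) = true → x (i + 2*k + 2) = false)

/-- An ordered block which is not a proper sub-block of another ordered block. -/
def IsMaximalOrderedBlock {n : ℕ} (x : ZMod n → Bool) (i : ZMod n) (k : ℕ) : Prop :=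
  IsOrderedBlock x i k ∧
  ∀ (i' : ZMod n) (k' d : ℕ), IsOrderedBlock x i' k' →
    i = i' + 2*d → 2*d + 2*k + 2 ≤ 2*k' + 2 → d = 0 ∧ k = k'

/-- `x` contains the word `w` starting at position `i`. -/
def ContainsAt {n : ℕ} (x : ZMod n → Bool) (i : ZMod n) (w : List Bool) : Prop :=
  ∀ j : Fin w.length, x (i + ((j : ℕ) : ZMod n)) = w.get j

/-- `x` belongs to `X_s`: the switch count is constant during the whole evolution
under the corrected BFO rule. -/
def InXs {n : ℕ} (x : ZMod n → Bool) : Prop :=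
  ∀ t : ℕ, switchCount (bfoGlobal^[t] x) = switchCount x

/-- Membership of the neighbourhood of cell `i` in one of the AT pairs
`T_{1,2}`, `T_{3,4}` (center at `i`). -/
def MatchT1234 {n : ℕ} (y : ZMod n → Bool) (i : ZMod n) : Prop :=
  (y (i-3) = true ∧ y (i-2) = true ∧ y (i-1) = true ∧ y i = false ∧ y (i+1) = false) ∨
  (y (i-4) = true ∧ y (i-3) = true ∧ y (i-2) = true ∧ y (i-1) = false ∧ y i = false) ∨
  (y (i-3) = false ∧ y (i-2) = false ∧ y (i-1) = true ∧ y i = false ∧ y (i+1) = false) ∨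
  (y (i-4) = false ∧ y (i-3) = false ∧ y (i-2) = true ∧ y (i-1) = false ∧ y i = false)

/-- The `k`-fold concatenation of a configuration of length `n`. -/
def concatK {n : ℕ} (k : ℕ) (x : ZMod n → Bool) : ZMod (k*n) → Bool :=
  fun i => x ((i.val : ZMod n))

/-- The local rule on nine explicit cells. -/
def bfoL (a0 a1 a2 a3 a4 a5 a6 a7 a8 : Bool) : Bool :=
  xor ((a1 && a2 && a3 && !a4 && !a5) ||
  (a0 && a1 && a2 && !a3 && !a4) ||
  (!a1 && !a2 && a3 && !a4 && !a5) ||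
  (!a0 && !a1 && a2 && !a3 && !a4) ||
  (!a3 && a4 && a5 && !a6) ||
  (!a2 && a3 && a4 && !a5) ||
  (!a1 && !a2 && a3 && !a4 && a5 && !a6) ||
  (!a2 && !a3 && a4 && !a5 && a6 && !a7) ||
  (a3 && a4 && a5 && !a6 && a7) ||
  (a0 && a1 && a2 && !a3 && a4 && !a5) ||
  (a0 && a1 && a2 && !a3 && a4 && a5 && a6) ||
  (a2 && a3 && a4 && !a5 && a6 && a7 && !a8)) a4

/-- Indicator of `10` which is not the start of `10100`. -/
def sg (a b c d e : Bool) : Bool := a && !b && !(c && !d && !e)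

/-- Indicator of `0110` not followed by `100`. -/
def d56 (a b c d e f g : Bool) : Bool := !a && b && c && !d && !(e && !f && !g)

/-- The flow (potential) used to balance the local changes of the switch count. -/
def flowJ (a0 a1 a2 a3 a4 a5 a6 a7 a8 a9 : Bool) : ℕ :=
    (bif a0 then (bif a1 then (bif a2 then (bif a3 then (bif a4 then (bif a5 then (bif a6 then 1
    else (bif a7 then (bif a8 then (bif a9 then 1 else 2) else 1) else 1)) else (bif a6 then (bif a7
    then (bif a8 then 1 else 2) else 1) else 1)) else (bif a5 then (bif a6 then 1 else (bif a7 then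
    1 else 2)) else 0)) else (bif a4 then (bif a5 then 1 else (bif a6 then 1 else 2)) else 0)) else
    (bif a3 then (bif a4 then (bif a5 then (bif a6 then 1 else (bif a7 then (bif a8 then (bif a9
    then 1 else 2) else 1) else 1)) else (bif a6 then (bif a7 then 2 else (bif a8 then 2 else 1))
    else 2)) else (bif a5 then (bif a6 then 1 else (bif a7 then (bif a8 then (bif a9 then 1 else 0)
    else 1) else 1)) else 1)) else 1)) else (bif a2 then (bif a3 then (bif a4 then (bif a5 then (bif
    a6 then 1 else (bif a7 then (bif a8 then (bif a9 then 1 else 2) else 1) else 1)) else (bif a6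
    then (bif a7 then (bif a8 then 1 else 2) else 1) else 1)) else 1) else (bif a4 then (bif a5 then
    1 else (bif a6 then (bif a7 then (bif a8 then 1 else 0) else 1) else 1)) else 1)) else (bif a3
    then (bif a4 then (bif a5 then (bif a6 then 1 else (bif a7 then (bif a8 then (bif a9 then 1 else
    2) else 1) else 1)) else (bif a6 then (bif a7 then 2 else (bif a8 then 2 else 1)) else 2)) else
    (bif a5 then (bif a6 then 1 else (bif a7 then 0 else 1)) else 0)) else 1))) else (bif a1 then
    (bif a2 then (bif a3 then (bif a4 then (bif a5 then (bif a6 then 1 else (bif a7 then (bif a8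
    then (bif a9 then 1 else 2) else 1) else 1)) else (bif a6 then (bif a7 then (bif a8 then 1 else
    2) else 1) else 1)) else (bif a5 then (bif a6 then 1 else (bif a7 then 1 else 2)) else 0)) else
    1) else (bif a3 then (bif a4 then (bif a5 then (bif a6 then 1 else (bif a7 then (bif a8 then
    (bif a9 then 1 else 2) else 1) else 1)) else (bif a6 then (bif a7 then 2 else (bif a8 then 2
    else 1)) else 2)) else (bif a5 then (bif a6 then (bif a7 then 1 else 0) else (bif a7 then (bif
    a8 then (bif a9 then 1 else 0) else 1) else 1)) else 1)) else 1)) else (bif a2 then (bif a3 then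
    (bif a4 then (bif a5 then (bif a6 then 1 else (bif a7 then (bif a8 then (bif a9 then 1 else 2)
    else 1) else 1)) else (bif a6 then (bif a7 then (bif a8 then 1 else 2) else 1) else 1)) else 1)
    else (bif a4 then (bif a5 then 1 else (bif a6 then 0 else 1)) else 0)) else (bif a3 then (bif a4
    then (bif a5 then (bif a6 then 1 else (bif a7 then (bif a8 then (bif a9 then 1 else 2) else 1)
    else 1)) else (bif a6 then (bif a7 then 2 else (bif a8 then 2 else 1)) else 2)) else (bif a5
    then (bif a6 then 1 else (bif a7 then 0 else 1)) else 0)) else 1))))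

/-- The local inequality. -/
def chk (a0 a1 a2 a3 a4 a5 a6 a7 a8 a9 a10 a11 a12 : Bool) : Bool :=
  Nat.ble ((sg (bfoL a0 a1 a2 a3 a4 a5 a6 a7 a8) (bfoL a1 a2 a3 a4 a5 a6 a7 a8 a9)
        (bfoL a2 a3 a4 a5 a6 a7 a8 a9 a10) (bfoL a3 a4 a5 a6 a7 a8 a9 a10 a11)
        (bfoL a4 a5 a6 a7 a8 a9 a10 a11 a12)).toNat
      + (d56 a3 a4 a5 a6 a7 a8 a9).toNat + flowJ a0 a1 a2 a3 a4 a5 a6 a7 a8 a9)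
    ((sg a4 a5 a6 a7 a8).toNat + flowJ a1 a2 a3 a4 a5 a6 a7 a8 a9 a10)

/-- Exhaustive check over a Boolean variable. -/
def allB (f : Bool → Bool) : Bool := f true && f false

theorem allB_spec {f : Bool → Bool} (h : allB f = true) (b : Bool) : f b = true := by
  unfold allB at h
  cases b <;> simp_all

theorem chk_all : (allB fun a0 => allB fun a1 => allB fun a2 => allB fun a3 => allB fun a4 =>
    allB fun a5 => allB fun a6 => allB fun a7 => allB fun a8 => allB fun a9 => allB fun a10 =>
    allB fun a11 => allB fun a12 => chk a0 a1 a2 a3 a4 a5 a6 a7 a8 a9 a10 a11 a12) = true := by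
  decide +kernel

theorem chk_true (a0 a1 a2 a3 a4 a5 a6 a7 a8 a9 a10 a11 a12 : Bool) :
    chk a0 a1 a2 a3 a4 a5 a6 a7 a8 a9 a10 a11 a12 = true :=
  allB_spec (allB_spec (allB_spec (allB_spec (allB_spec (allB_spec (allB_spec (allB_spec
    (allB_spec (allB_spec (allB_spec (allB_spec (allB_spec chk_all a0) a1) a2) a3) a4) a5) a6)
    a7) a8) a9) a10) a11) a12

theorem bfoGlobal_eq {n : ℕ} (x : ZMod n → Bool) (i : ZMod n) :
    bfoGlobal x (i+4) = bfoL (x i) (x (i+1)) (x (i+2)) (x (i+3)) (x (i+4)) (x (i+5)) (x (i+6))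
      (x (i+7)) (x (i+8)) := by
  have e : ∀ j : ZMod n, i + 4 + j - 4 = i + j := fun j => by ring
  simp only [bfoGlobal, globalRule, bfoLocal, bfoActive, bfoL, Nat.cast_ofNat, e]
  have h0 : (((0 : Fin 9) : ℕ) : ZMod n) = 0 := by simp
  have h1 : (((1 : Fin 9) : ℕ) : ZMod n) = 1 := by simp
  have h2 : (((2 : Fin 9) : ℕ) : ZMod n) = 2 := by norm_cast
  have h3 : (((3 : Fin 9) : ℕ) : ZMod n) = 3 := by norm_cast
  have h4 : (((4 : Fin 9) : ℕ) : ZMod n) = 4 := by norm_cast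
  have h5 : (((5 : Fin 9) : ℕ) : ZMod n) = 5 := by norm_cast
  have h6 : (((6 : Fin 9) : ℕ) : ZMod n) = 6 := by norm_cast
  have h7 : (((7 : Fin 9) : ℕ) : ZMod n) = 7 := by norm_cast
  have h8 : (((8 : Fin 9) : ℕ) : ZMod n) = 8 := by norm_cast
  erw [h0, h1, h2, h3, h4, h5, h6, h7, h8]
  simp only [add_zero]

/-- `sg` at position `i` of `x`. -/
def sgAt {n : ℕ} (x : ZMod n → Bool) (i : ZMod n) : ℕ :=
  (sg (x i) (x (i+1)) (x (i+2)) (x (i+3)) (x (i+4))).toNat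

def dAt {n : ℕ} (x : ZMod n → Bool) (i : ZMod n) : ℕ :=
  (d56 (x i) (x (i+1)) (x (i+2)) (x (i+3)) (x (i+4)) (x (i+5)) (x (i+6))).toNat

def jAt {n : ℕ} (x : ZMod n → Bool) (i : ZMod n) : ℕ :=
  flowJ (x i) (x (i+1)) (x (i+2)) (x (i+3)) (x (i+4)) (x (i+5)) (x (i+6)) (x (i+7)) (x (i+8))
    (x (i+9))

theorem local_ineq {n : ℕ} (x : ZMod n → Bool) (i : ZMod n) :
    sgAt (bfoGlobal x) (i+4) + dAt x (i+3) + jAt x i ≤ sgAt x (i+4) + jAt x (i+1) := by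
  have h := chk_true (x i) (x (i+1)) (x (i+2)) (x (i+3)) (x (i+4)) (x (i+5)) (x (i+6))
      (x (i+7)) (x (i+8)) (x (i+9)) (x (i+10)) (x (i+11)) (x (i+12))
  have h' := Nat.le_of_ble_eq_true h
  have y1 : i + 4 + 1 = (i + 1) + 4 := by ring
  have y2 : i + 4 + 2 = (i + 2) + 4 := by ring
  have y3 : i + 4 + 3 = (i + 3) + 4 := by ring
  have e1 : sgAt (bfoGlobal x) (i+4) = (sg (bfoGlobal x (i+4)) (bfoGlobal x ((i+1)+4))
      (bfoGlobal x ((i+2)+4)) (bfoGlobal x ((i+3)+4)) (bfoGlobal x ((i+4)+4))).toNat := by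
    unfold sgAt
    rw [y1, y2, y3]
  simp only [bfoGlobal_eq] at e1
  rw [e1]
  unfold dAt jAt sgAt
  simp only [add_assoc] at h' ⊢
  norm_num at h' ⊢
  exact h'

theorem sum_ineq {n : ℕ} [NeZero n] (x : ZMod n → Bool) :
    ∑ i, sgAt (bfoGlobal x) i + ∑ i, dAt x i ≤ ∑ i, sgAt x i := by
  have h : ∑ i, (sgAt (bfoGlobal x) (i+4) + dAt x (i+3) + jAt x i)
      ≤ ∑ i, (sgAt x (i+4) + jAt x (i+1)) := Finset.sum_le_sum fun i _ => local_ineq x i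
  simp only [Finset.sum_add_distrib] at h
  have s1 := Equiv.sum_comp (Equiv.addRight (4 : ZMod n)) (sgAt (bfoGlobal x))
  have s2 := Equiv.sum_comp (Equiv.addRight (3 : ZMod n)) (dAt x)
  have s3 := Equiv.sum_comp (Equiv.addRight (4 : ZMod n)) (sgAt x)
  have s4 := Equiv.sum_comp (Equiv.addRight (1 : ZMod n)) (jAt x)
  simp only [Equiv.coe_addRight] at s1 s2 s3 s4
  omega

/-- Box indicator. -/
def bx {n : ℕ} (x : ZMod n → Bool) (i : ZMod n) : ℕ :=
  (x (i-1) && !x i && x (i+1) && !x (i+2) && !x (i+3)).toNat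

open Classical in
theorem switch_local {n : ℕ} (x : ZMod n → Bool) (i : ZMod n) :
    (if IsSwitch x i then 1 else 0) + bx x i + bx x (i-1) + (x i).toNat
      = 2 * (sgAt x i + bx x (i+1)) + (x (i+1)).toNat := by
  have hin : ∀ j, InBox x j ↔ (IsBox x j ∨ IsBox x (j-1)) := by
    intro j
    constructor
    · rintro ⟨a, ha, rfl | rfl⟩
      · exact Or.inl ha
      · right; simpa using ha
    · rintro (h | h)
      · exact ⟨j, h, Or.inl rfl⟩
      · exact ⟨j-1, h, Or.inr (by ring)⟩
  unfold IsSwitch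
  simp only [hin]
  have e1 : i + 1 - 1 = i := by ring
  simp only [e1]
  unfold IsBox bx sgAt sg
  have f1 : i + 1 + 1 = i + 2 := by ring
  have f2 : i + 1 + 2 = i + 3 := by ring
  have f3 : i + 1 + 3 = i + 4 := by ring
  have f4 : i - 1 - 1 = i - 2 := by ring
  have f5 : i - 1 + 1 = i := by ring
  have f6 : i - 1 + 2 = i + 1 := by ring
  have f7 : i - 1 + 3 = i + 2 := by ring
  simp only [f1, f2, f3, f4, f5, f6, f7, e1]
  generalize x (i-2) = a
  generalize x (i-1) = b
  generalize x i = c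
  generalize x (i+1) = d
  generalize x (i+2) = e
  generalize x (i+3) = f
  generalize x (i+4) = g
  cases a <;> cases b <;> cases c <;> cases d <;> cases e <;> cases f <;> cases g <;> simp

theorem switchCount_eq {n : ℕ} [NeZero n] (x : ZMod n → Bool) :
    switchCount x = 2 * ∑ i, sgAt x i := by
  classical
  have h : ∑ i, ((if IsSwitch x i then 1 else 0) + bx x i + bx x (i-1) + (x i).toNat)
      = ∑ i, (2 * (sgAt x i + bx x (i+1)) + (x (i+1)).toNat) :=
    Finset.sum_congr rfl fun i _ => switch_local x i
  simp only [Finset.sum_add_distrib, ← Finset.mul_sum] at h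
  have s1 := Equiv.sum_comp (Equiv.addRight (1 : ZMod n)) (bx x)
  have s2 := Equiv.sum_comp (Equiv.subRight (1 : ZMod n)) (bx x)
  have s3 := Equiv.sum_comp (Equiv.addRight (1 : ZMod n)) (fun i => (x i).toNat)
  simp only [Equiv.coe_addRight, Equiv.subRight_apply] at s1 s2 s3
  have hc : switchCount x = ∑ i, (if IsSwitch x i then 1 else 0) := by
    unfold switchCount
    rw [Nat.card_eq_fintype_card, Fintype.card_subtype, Finset.card_filter]
  omega

theorem no_d56 {n : ℕ} [NeZero n] (x : ZMod n → Bool) (hx : InXs x) (i : ZMod n) :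
    d56 (x i) (x (i+1)) (x (i+2)) (x (i+3)) (x (i+4)) (x (i+5)) (x (i+6)) = false := by
  have h1 := hx 1
  simp only [Function.iterate_one] at h1
  rw [switchCount_eq, switchCount_eq] at h1
  have h2 := sum_ineq x
  have h3 : dAt x i ≤ ∑ i, dAt x i :=
    Finset.single_le_sum (f := dAt x) (fun _ _ => Nat.zero_le _) (Finset.mem_univ i)
  have h4 : dAt x i = 0 := by omega
  unfold dAt at h4
  simpa using h4

/-- If `x ∈ X_s` and `b` is a maximal ordered block in `x`, then
`b` does not contain `001100` and does not end with `0011`. -/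
theorem Xs_maximal_block_no_001100 (n : ℕ) (hn : Odd n) (x : ZMod n → Bool)
    (hx : InXs x) (i : ZMod n) (k : ℕ) (hb : IsMaximalOrderedBlock x i k) :
    (¬ ∃ j : ℕ, j + 6 ≤ 2*k + 2 ∧
        ContainsAt x (i + (j : ZMod n)) [false, false, true, true, false, false]) ∧
    ¬ (x (i + ((2*k - 2 : ℕ) : ZMod n)) = false ∧
       x (i + ((2*k - 1 : ℕ) : ZMod n)) = false ∧
       x (i + 2*k) = true ∧ x (i + 2*k + 1) = true) := by
  have : NeZero n := ⟨by rintro rfl; simp at hn⟩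
  constructor
  · rintro ⟨j, -, hc⟩
    have h1 := hc ⟨1, by simp⟩
    have h2 := hc ⟨2, by simp⟩
    have h3 := hc ⟨3, by simp⟩
    have h4 := hc ⟨4, by simp⟩
    have h5 := hc ⟨5, by simp⟩
    have h := no_d56 x hx (i + j + 1)
    simp only [add_assoc] at h h1 h2 h3 h4 h5
    norm_num at h h1 h2 h3 h4 h5
    simp [d56, h1, h2, h3, h4, h5] at h
  · rintro ⟨-, h1, h2, h3⟩
    obtain ⟨⟨o1, o2, o3, o4⟩, hmax⟩ := hb
    rcases Nat.eq_zero_or_pos k with rfl | hk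
    · simp [o2.1] at h2
    · have h4 := o4 ⟨h2, h3⟩
      have e : ((2*k - 1 : ℕ) : ZMod n) = 2*k - 1 := by
        rw [Nat.cast_sub (by omega)]; simp
      rw [e] at h1
      have h := no_d56 x hx (i + (2*k - 1))
      have g1 : i + (2*(k : ZMod n) - 1) + 1 = i + 2*k := by ring
      have g2 : i + (2*(k : ZMod n) - 1) + 2 = i + 2*k + 1 := by ring
      have g3 : i + (2*(k : ZMod n) - 1) + 3 = i + 2*k + 2 := by ring
      have g4 : i + (2*(k : ZMod n) - 1) + 4 = i + 2*k + 3 := by ring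
      have g5 : i + (2*(k : ZMod n) - 1) + 5 = i + 2*k + 4 := by ring
      have g6 : i + (2*(k : ZMod n) - 1) + 6 = i + 2*k + 5 := by ring
      rw [g1, g2, g3, g4, g5, g6] at h
      simp [d56, h1, h2, h3, h4] at h
      obtain ⟨⟨k3, k4⟩, k5⟩ : (x (i + 2*k + 3) = true ∧ x (i + 2*k + 4) = false) ∧
          x (i + 2*k + 5) = false := by tauto
      have a1 : i + 2 * ((k + 2 : ℕ) : ZMod n) = i + 2*k + 4 := by push_cast; ring
      have a2 : i + 2*(k : ZMod n) + 4 + 1 = i + 2*k + 5 := by ring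
      have b1 : i + 2 * ((k + 1 : ℕ) : ZMod n) = i + 2*k + 2 := by push_cast; ring
      have ho : IsOrderedBlock x i (k+2) := by
        refine ⟨?_, o2, ?_, ?_⟩
        · intro j hj
          rcases Nat.lt_or_ge k j with hlt | hle
          · rcases (show j = k + 1 ∨ j = k + 2 by omega) with rfl | rfl
            · rw [b1]; simp [h4]
            · rw [a1]; simp [k4]
          · exact o1 j hle
        · rw [a1, a2]; simp [k5]
        · rw [a1]; simp [k4]
      have := hmax i (k+2) 0 ho (by simp) (by omega)
      omega
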